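/- Suppose α, β > 0 and the matrix M = [[(1/α)Iₙ − P, −Hᵀ], [−H, (1/β)Iₘ]] is positive semidefinite. Define S : ℝ^{n+m} → ℝ^{n+m} by S(ξ, η) = (z⁺, w⁺), where z⁺ = π_D[ξ − α(Pξ + q + Hᵀη)] and w⁺ = π_{K°}[η + β(H(2z⁺ − ξ) − g)]. Then S is firmly nonexpansive in the M-inner product: for all ζ₁, ζ₂ ∈ ℝ^{n+m}, ⟨S(ζ₁) − S(ζ₂), ζ₁ − ζ₂ − S(ζ₁) + S(ζ₂)⟩_M ≥ 0. -/

import Mathlib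

open scoped RealInnerProductSpace
open Matrix

/-- The linear map on Euclidean space induced by a matrix (matrix-vector product). -/
noncomputable def mvec {ι κ : Type*} [Fintype ι] [Fintype κ] [DecidableEq κ]
    (A : Matrix ι κ ℝ) (x : EuclideanSpace ℝ κ) : EuclideanSpace ℝ ι :=
  Matrix.toEuclideanLin A x

open Classical in
/-- Projection onto a (nonempty closed convex) set: the minimizer of the distance to `x`. -/
noncomputable def proj {ι : Type*} [Fintype ι] (C : Set (EuclideanSpace ℝ ι))
    (x : EuclideanSpace ℝ ι) : EuclideanSpace ℝ ι :=
  if h : ∃ y ∈ C, ∀ c ∈ C, ‖x - y‖ ≤ ‖x - c‖ then h.choose else x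

/-- Polar cone `K° = {w | ⟨w, y⟩ ≤ 0 for all y ∈ K}`. -/
def polarCone {ι : Type*} [Fintype ι] (K : Set (EuclideanSpace ℝ ι)) :
    Set (EuclideanSpace ℝ ι) := {w | ∀ y ∈ K, ⟪w, y⟫ ≤ 0}

/-- A nonempty closed convex cone. -/
def IsClosedConvexCone {ι : Type*} [Fintype ι] (K : Set (EuclideanSpace ℝ ι)) : Prop :=
  IsClosed K ∧ Convex ℝ K ∧ ∀ w ∈ K, ∀ c : ℝ, 0 ≤ c → c • w ∈ K

/-- Concatenation `(ξ, η) ↦ ζ` of two Euclidean vectors into `ℝ^{n+m}`. -/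
noncomputable def join {ι κ : Type*} (x : EuclideanSpace ℝ ι) (y : EuclideanSpace ℝ κ) :
    EuclideanSpace ℝ (ι ⊕ κ) :=
  (WithLp.equiv 2 _).symm (Sum.elim ((WithLp.equiv 2 _) x) ((WithLp.equiv 2 _) y))

/-- First block of a vector in `ℝ^{n+m}`. -/
noncomputable def split₁ {ι κ : Type*} (ζ : EuclideanSpace ℝ (ι ⊕ κ)) : EuclideanSpace ℝ ι :=
  (WithLp.equiv 2 _).symm fun i => (WithLp.equiv 2 _) ζ (Sum.inl i)

/-- Second block of a vector in `ℝ^{n+m}`. -/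
noncomputable def split₂ {ι κ : Type*} (ζ : EuclideanSpace ℝ (ι ⊕ κ)) : EuclideanSpace ℝ κ :=
  (WithLp.equiv 2 _).symm fun i => (WithLp.equiv 2 _) ζ (Sum.inr i)

/-- On a nonempty closed convex set, `proj` returns a point of the set at minimal distance. -/
theorem proj_spec {ι : Type*} [Fintype ι] {C : Set (EuclideanSpace ℝ ι)} (hne : C.Nonempty)
    (hcl : IsClosed C) (x : EuclideanSpace ℝ ι) :
    proj C x ∈ C ∧ ∀ c ∈ C, ‖x - proj C x‖ ≤ ‖x - c‖ := by
  have h : ∃ y ∈ C, ∀ c ∈ C, ‖x - y‖ ≤ ‖x - c‖ := by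
    obtain ⟨y, hy, hxy⟩ := hcl.exists_infDist_eq_dist hne x
    refine ⟨y, hy, fun c hc => ?_⟩
    rw [← dist_eq_norm, ← dist_eq_norm, ← hxy]
    exact Metric.infDist_le_dist_of_mem hc
  rw [proj, dif_pos h]
  exact h.choose_spec

/-- The variational inequality characterizing the projection onto a closed convex set. -/
theorem inner_sub_proj_le_zero {ι : Type*} [Fintype ι] {C : Set (EuclideanSpace ℝ ι)}
    (hne : C.Nonempty) (hcl : IsClosed C) (hcv : Convex ℝ C) (x : EuclideanSpace ℝ ι)
    {c : EuclideanSpace ℝ ι} (hc : c ∈ C) : ⟪x - proj C x, c - proj C x⟫ ≤ 0 := by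
  obtain ⟨hmem, hmin⟩ := proj_spec hne hcl x
  refine (norm_eq_iInf_iff_real_inner_le_zero hcv hmem).1 (le_antisymm ?_ ?_) c hc
  · have : Nonempty C := hne.to_subtype
    exact le_ciInf fun w => hmin w w.2
  · exact ciInf_le ⟨0, by rintro _ ⟨w, rfl⟩; exact norm_nonneg _⟩ (⟨_, hmem⟩ : C)

/-- The projection onto a closed convex set is firmly nonexpansive. -/
theorem proj_firmly_nonexpansive {ι : Type*} [Fintype ι] {C : Set (EuclideanSpace ℝ ι)}
    (hne : C.Nonempty) (hcl : IsClosed C) (hcv : Convex ℝ C) (x y : EuclideanSpace ℝ ι) :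
    0 ≤ ⟪proj C x - proj C y, (x - y) - (proj C x - proj C y)⟫ := by
  have h₁ := inner_sub_proj_le_zero hne hcl hcv x (proj_spec hne hcl y).1
  have h₂ := inner_sub_proj_le_zero hne hcl hcv y (proj_spec hne hcl x).1
  have e : ⟪proj C x - proj C y, (x - y) - (proj C x - proj C y)⟫ =
      -⟪x - proj C x, proj C y - proj C x⟫ - ⟪y - proj C y, proj C x - proj C y⟫ := by
    rw [real_inner_comm]
    simp only [inner_sub_left, inner_sub_right]
    ring
  linarith

theorem polarCone_nonempty {ι : Type*} [Fintype ι] (K : Set (EuclideanSpace ℝ ι)) :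
    (polarCone K).Nonempty :=
  ⟨0, fun y _ => by simp⟩

theorem isClosed_polarCone {ι : Type*} [Fintype ι] (K : Set (EuclideanSpace ℝ ι)) :
    IsClosed (polarCone K) := by
  simp only [polarCone, Set.ofPred_forall]
  exact isClosed_biInter fun y _ => isClosed_le (by fun_prop) continuous_const

theorem convex_polarCone {ι : Type*} [Fintype ι] (K : Set (EuclideanSpace ℝ ι)) :
    Convex ℝ (polarCone K) := by
  intro u hu v hv a b ha hb _ y hy
  rw [inner_add_left, real_inner_smul_left, real_inner_smul_left]
  nlinarith [mul_nonneg ha (neg_nonneg.2 (hu y hy)), mul_nonneg hb (neg_nonneg.2 (hv y hy))]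

theorem inner_mvec_transpose {ι κ : Type*} [Fintype ι] [Fintype κ] [DecidableEq ι]
    [DecidableEq κ] (A : Matrix ι κ ℝ) (x : EuclideanSpace ℝ κ) (y : EuclideanSpace ℝ ι) :
    ⟪x, mvec Aᵀ y⟫ = ⟪y, mvec A x⟫ := by
  rw [mvec, ← conjTranspose_eq_transpose_of_trivial, toEuclideanLin_conjTranspose_eq_adjoint,
    LinearMap.adjoint_inner_right, real_inner_comm, mvec]

theorem inner_mvec_self_nonneg {ι : Type*} [Fintype ι] [DecidableEq ι] {P : Matrix ι ι ℝ}
    (hP : P.PosSemidef) (x : EuclideanSpace ℝ ι) : 0 ≤ ⟪x, mvec P x⟫ := by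
  have := hP.dotProduct_mulVec_nonneg x.ofLp
  simpa [mvec, EuclideanSpace.inner_eq_star_dotProduct, dotProduct_comm] using this

/-- The bilinear form of a block matrix, evaluated on a concatenated vector. -/
theorem inner_join_mvec_fromBlocks {ι κ : Type*} [Fintype ι] [Fintype κ] [DecidableEq ι]
    [DecidableEq κ] (A : Matrix ι ι ℝ) (B : Matrix ι κ ℝ) (C : Matrix κ ι ℝ)
    (E : Matrix κ κ ℝ) (x : EuclideanSpace ℝ ι) (y : EuclideanSpace ℝ κ)
    (ζ : EuclideanSpace ℝ (ι ⊕ κ)) :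
    ⟪join x y, mvec (fromBlocks A B C E) ζ⟫ =
      ⟪x, mvec A (split₁ ζ) + mvec B (split₂ ζ)⟫ +
        ⟪y, mvec C (split₁ ζ) + mvec E (split₂ ζ)⟫ := by
  simp [join, split₁, split₂, mvec, PiLp.inner_apply, mulVec, dotProduct]

theorem join_sub {ι κ : Type*} (x x' : EuclideanSpace ℝ ι) (y y' : EuclideanSpace ℝ κ) :
    join x y - join x' y' = join (x - x') (y - y') := by
  ext (i | i) <;> simp [join]

theorem toEuclideanLin_one_apply {ι : Type*} [Fintype ι] [DecidableEq ι]
    (x : EuclideanSpace ℝ ι) : toEuclideanLin (1 : Matrix ι ι ℝ) x = x := by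
  ext i
  simp

/-- Suppose `α, β > 0` and the block matrix
`M = [[(1/α)Iₙ − P, −Hᵀ], [−H, (1/β)Iₘ]]` is positive semidefinite.  Then the map
`S(ξ, η) = (z⁺, w⁺)`, where `z⁺ = π_D[ξ − α(Pξ + q + Hᵀη)]` and
`w⁺ = π_{K°}[η + β(H(2z⁺ − ξ) − g)]`, is firmly nonexpansive in the `M`-inner product:
`⟨S(ζ₁) − S(ζ₂), ζ₁ − ζ₂ − S(ζ₁) + S(ζ₂)⟩_M ≥ 0` for all `ζ₁, ζ₂`. -/
theorem stmt2 {n m : ℕ} (P : Matrix (Fin n) (Fin n) ℝ) (q : EuclideanSpace ℝ (Fin n))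
    (H : Matrix (Fin m) (Fin n) ℝ) (g : EuclideanSpace ℝ (Fin m))
    (D : Set (EuclideanSpace ℝ (Fin n))) (K : Set (EuclideanSpace ℝ (Fin m)))
    (hP : P.PosSemidef)
    (hDne : D.Nonempty) (hDcl : IsClosed D) (hDcv : Convex ℝ D)
    (hKne : K.Nonempty) (hK : IsClosedConvexCone K)
    (α β : ℝ) (hα : 0 < α) (hβ : 0 < β)
    (M : Matrix (Fin n ⊕ Fin m) (Fin n ⊕ Fin m) ℝ)
    (hM : M = Matrix.fromBlocks ((1/α) • (1 : Matrix (Fin n) (Fin n) ℝ) - P) (-Hᵀ) (-H)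
      ((1/β) • (1 : Matrix (Fin m) (Fin m) ℝ)))
    (hMpsd : M.PosSemidef)
    (zp : EuclideanSpace ℝ (Fin n ⊕ Fin m) → EuclideanSpace ℝ (Fin n))
    (wp : EuclideanSpace ℝ (Fin n ⊕ Fin m) → EuclideanSpace ℝ (Fin m))
    (hzp : ∀ ζ, zp ζ =
      proj D (split₁ ζ - α • (mvec P (split₁ ζ) + q + mvec Hᵀ (split₂ ζ))))
    (hwp : ∀ ζ, wp ζ =
      proj (polarCone K) (split₂ ζ + β • (mvec H ((2 : ℝ) • zp ζ - split₁ ζ) - g)))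
    (S : EuclideanSpace ℝ (Fin n ⊕ Fin m) → EuclideanSpace ℝ (Fin n ⊕ Fin m))
    (hS : ∀ ζ, S ζ = join (zp ζ) (wp ζ)) :
    ∀ ζ₁ ζ₂, 0 ≤ ⟪S ζ₁ - S ζ₂, mvec M (ζ₁ - ζ₂ - S ζ₁ + S ζ₂)⟫ := by
  intro ζ₁ ζ₂
  have hz := proj_firmly_nonexpansive hDne hDcl hDcv
    (split₁ ζ₁ - α • (mvec P (split₁ ζ₁) + q + mvec Hᵀ (split₂ ζ₁)))
    (split₁ ζ₂ - α • (mvec P (split₁ ζ₂) + q + mvec Hᵀ (split₂ ζ₂)))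
  have hw := proj_firmly_nonexpansive (polarCone_nonempty K) (isClosed_polarCone K)
    (convex_polarCone K)
    (split₂ ζ₁ + β • (mvec H ((2 : ℝ) • zp ζ₁ - split₁ ζ₁) - g))
    (split₂ ζ₂ + β • (mvec H ((2 : ℝ) • zp ζ₂ - split₁ ζ₂) - g))
  rw [← hzp, ← hzp] at hz
  rw [← hwp, ← hwp] at hw
  have h₁ : split₁ (ζ₁ - ζ₂ - S ζ₁ + S ζ₂) =
      (split₁ ζ₁ - split₁ ζ₂) - (zp ζ₁ - zp ζ₂) := by
    ext i; simp [split₁, hS, join]; ring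
  have h₂ : split₂ (ζ₁ - ζ₂ - S ζ₁ + S ζ₂) =
      (split₂ ζ₁ - split₂ ζ₂) - (wp ζ₁ - wp ζ₂) := by
    ext i; simp [split₂, hS, join]; ring
  rw [hM, hS ζ₁, hS ζ₂, join_sub, ← hS ζ₁, ← hS ζ₂, inner_join_mvec_fromBlocks, h₁, h₂]
  set z := zp ζ₁ - zp ζ₂ with hz_def
  set w := wp ζ₁ - wp ζ₂
  set a := split₁ ζ₁ - split₁ ζ₂ with ha
  set b := split₂ ζ₁ - split₂ ζ₂ with hb
  have hu : split₁ ζ₁ - α • (mvec P (split₁ ζ₁) + q + mvec Hᵀ (split₂ ζ₁)) -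
      (split₁ ζ₂ - α • (mvec P (split₁ ζ₂) + q + mvec Hᵀ (split₂ ζ₂))) - z =
      α • ((1 / α) • (a - z) - mvec P a - mvec Hᵀ b) := by
    simp only [ha, hb, mvec, map_sub, smul_sub, smul_add, smul_smul, mul_one_div_cancel hα.ne',
      one_smul]
    abel
  have hv : split₂ ζ₁ + β • (mvec H ((2 : ℝ) • zp ζ₁ - split₁ ζ₁) - g) -
      (split₂ ζ₂ + β • (mvec H ((2 : ℝ) • zp ζ₂ - split₁ ζ₂) - g)) - w =
      β • ((1 / β) • (b - w) + (2 : ℝ) • mvec H z - mvec H a) := by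
    simp only [ha, hb, hz_def, mvec, map_sub, map_smul, smul_sub, smul_add, smul_smul,
      mul_one_div_cancel hβ.ne', one_smul]
    abel
  rw [hu, real_inner_smul_right] at hz
  rw [hv, real_inner_smul_right] at hw
  have hz' := nonneg_of_mul_nonneg_right hz hα
  have hw' := nonneg_of_mul_nonneg_right hw hβ
  have hPz := inner_mvec_self_nonneg hP z
  have hHw := inner_mvec_transpose H z w
  simp only [mvec, map_sub, map_neg, map_smul, toEuclideanLin_one_apply, LinearMap.sub_apply,
    LinearMap.neg_apply, LinearMap.smul_apply, inner_add_right,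
    inner_sub_right, inner_neg_right, real_inner_smul_right] at hz' hw' hPz hHw ⊢
  linarith
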